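/- arXiv:2311.10052 — 12 statements merged into one kernel-verified Lean document; each statement's English description precedes it below -/
import Mathlib

section
/- Let λ, μ > 0 and p, q ∈ [0,1]. Define π_∅ = (μ + λq(1−p)) / (λ + μ + λq(1−p)) and, for each integer i ≥ 0, π_i = (λ^{i+1} q^i p^i / (μ + λq)^{i+1}) · π_∅. Then: (i) π_∅ + ∑_{i=0}^∞ π_i = 1; (ii) λ π_∅ = (μ + λq(1−p)) ∑_{i=0}^∞ π_i; (iii) (μ + λq) π_0 = λ π_∅; (iv) for every i ≥ 1, (μ + λq) π_i = λqp · π_{i−1}; and (v) 1 − π_∅ = λ / (λ + μ + λq(1−p)). In particular the given family (π_∅, π_0, π_1, …) is a probability distribution satisfying the global balance equations of the 1G1B continuous-time Markov chain, and the availability A = 1 − π_∅ equals λ / (λ + μ + λq(1−p)). -/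
/-- **Stationary distribution and availability of the 1G1B chain.**
For `λ, μ > 0` and `p, q ∈ [0,1]`, the family
`π_∅ = (μ + λq(1−p))/(λ + μ + λq(1−p))`,
`π_i = (λ^{i+1} q^i p^i / (μ + λq)^{i+1}) π_∅`
is a probability distribution satisfying the global balance equations of the
1G1B continuous-time Markov chain, and the availability `A = 1 − π_∅` equals
`λ/(λ + μ + λq(1−p))`. -/
theorem stmt_0 (lam mu p q : ℝ) (hlam : 0 < lam) (hmu : 0 < mu)
    (hp : p ∈ Set.Icc (0:ℝ) 1) (hq : q ∈ Set.Icc (0:ℝ) 1)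
    (piE : ℝ) (pii : ℕ → ℝ)
    (hpiE : piE = (mu + lam * q * (1 - p)) / (lam + mu + lam * q * (1 - p)))
    (hpii : ∀ i : ℕ, pii i = lam ^ (i + 1) * q ^ i * p ^ i / (mu + lam * q) ^ (i + 1) * piE) :
    piE + ∑' i : ℕ, pii i = 1 ∧
    lam * piE = (mu + lam * q * (1 - p)) * ∑' i : ℕ, pii i ∧
    (mu + lam * q) * pii 0 = lam * piE ∧
    (∀ i : ℕ, 1 ≤ i → (mu + lam * q) * pii i = lam * q * p * pii (i - 1)) ∧
    1 - piE = lam / (lam + mu + lam * q * (1 - p)) := by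
  obtain ⟨hp0, hp1⟩ := hp
  obtain ⟨hq0, hq1⟩ := hq
  have hlq : 0 ≤ lam * q := by positivity
  have hS : 0 < mu + lam * q := by positivity
  have hd : 0 < mu + lam * q * (1 - p) := by
    have := mul_nonneg hlq (sub_nonneg.2 hp1)
    linarith
  have hD : 0 < lam + mu + lam * q * (1 - p) := by linarith
  have hr1 : lam * q * p / (mu + lam * q) < 1 := by
    rw [div_lt_one hS]
    linarith
  have hgeom : ∀ i, pii i =
      lam / (mu + lam * q) * piE * (lam * q * p / (mu + lam * q)) ^ i := by
    intro i
    rw [hpii, div_pow, mul_pow, mul_pow, pow_succ, pow_succ]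
    field_simp
  have htsum : ∑' i, pii i = lam / (lam + mu + lam * q * (1 - p)) := by
    have h1r : 1 - lam * q * p / (mu + lam * q) =
        (mu + lam * q * (1 - p)) / (mu + lam * q) := by
      field_simp
      ring
    rw [tsum_congr hgeom, tsum_mul_left, tsum_geometric_of_lt_one (by positivity) hr1, h1r, hpiE]
    field_simp
  refine ⟨?_, ?_, ?_, ?_, ?_⟩
  · rw [htsum, hpiE, ← add_div, div_eq_one_iff_eq hD.ne']
    ring
  · rw [htsum, hpiE]
    ring
  · rw [hgeom, pow_zero]
    field_simp
  · intro i hi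
    obtain ⟨k, rfl⟩ := Nat.exists_eq_add_of_le' hi
    rw [Nat.add_sub_cancel, hgeom, hgeom, pow_succ]
    field_simp
  · rw [hpiE, one_sub_div hD.ne']
    ring
end

section
/- Fix Γ ≥ 0, a, b, F_new ∈ ℝ. Define D_t(F) = e^{−Γt}(F − 1/4) + 1/4 for t ≥ 0, and define functions F^{(i)} recursively by F^{(0)}(t_0) = D_{t_0}(F_new) and F^{(i)}(t_0,…,t_i) = D_{t_i}(a · F^{(i−1)}(t_0,…,t_{i−1}) + b) for i ≥ 1. Then for all i ≥ 0 and all t_0,…,t_i ≥ 0, F^{(i)}(t_0,…,t_i) = 1/4 + ∑_{j=0}^i m_j^{(i)} e^{−Γ(t_j + t_{j+1} + … + t_i)}, where m_0^{(i)} = a^i (F_new − 1/4) and, for 1 ≤ j ≤ i, m_j^{(i)} = a^{i−j} (a/4 + b − 1/4). -/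
/-- **Closed form of the fidelity after `i` purification rounds (linear jump).**
With depolarising noise `D_t(F) = e^{−Γt}(F − 1/4) + 1/4` and linear jump
`J(F) = aF + b`, the recursion `F⁽⁰⁾(t₀) = D_{t₀}(F_new)`,
`F⁽ⁱ⁾(t₀,…,tᵢ) = D_{tᵢ}(a F⁽ⁱ⁻¹⁾ + b)` has the explicit solution
`F⁽ⁱ⁾ = 1/4 + ∑_{j=0}^i m_j⁽ⁱ⁾ e^{−Γ(t_j + … + t_i)}` with
`m₀⁽ⁱ⁾ = aⁱ(F_new − 1/4)` and `m_j⁽ⁱ⁾ = a^{i−j}(a/4 + b − 1/4)` for `j ≥ 1`. -/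
theorem stmt_2 (Γ a b Fnew : ℝ) (hΓ : 0 ≤ Γ)
    (FF : ℕ → (ℕ → ℝ) → ℝ)
    (h0 : ∀ t : ℕ → ℝ, FF 0 t = Real.exp (-Γ * t 0) * (Fnew - 1/4) + 1/4)
    (hrec : ∀ (i : ℕ) (t : ℕ → ℝ),
      FF (i + 1) t = Real.exp (-Γ * t (i + 1)) * ((a * FF i t + b) - 1/4) + 1/4) :
    ∀ (i : ℕ) (t : ℕ → ℝ), (∀ j : ℕ, 0 ≤ t j) →
      FF i t = 1/4 + ∑ j ∈ Finset.range (i + 1),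
        (if j = 0 then a ^ i * (Fnew - 1/4) else a ^ (i - j) * (a/4 + b - 1/4)) *
          Real.exp (-Γ * ∑ k ∈ Finset.Icc j i, t k) := by
  intro i t _
  induction i with
  | zero => simp [h0, mul_comm, add_comm]
  | succ i ih =>
    have hstep : ∀ j ∈ Finset.range (i + 1),
        (if j = 0 then a ^ (i + 1) * (Fnew - 1/4)
          else a ^ (i + 1 - j) * (a/4 + b - 1/4)) *
            Real.exp (-Γ * ∑ k ∈ Finset.Icc j (i + 1), t k) =
        (a * Real.exp (-Γ * t (i + 1))) *
          ((if j = 0 then a ^ i * (Fnew - 1/4) else a ^ (i - j) * (a/4 + b - 1/4)) *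
            Real.exp (-Γ * ∑ k ∈ Finset.Icc j i, t k)) := by
      intro j hj
      have hji : j ≤ i := Nat.lt_succ_iff.mp (Finset.mem_range.mp hj)
      rw [Finset.sum_Icc_succ_top (by omega), mul_add, Real.exp_add,
        Nat.succ_sub hji, pow_succ, pow_succ]
      split_ifs <;> ring
    rw [hrec, ih, Finset.sum_range_succ _ (i + 1), Finset.sum_congr rfl hstep,
      ← Finset.mul_sum]
    simp only [Nat.add_eq_zero_iff, one_ne_zero, and_false, if_false, Nat.sub_self,
      pow_zero, Finset.Icc_self, Finset.sum_singleton]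
    ring
end

section
/- Fix Γ > 0, α > 0, a ∈ [0,1], b, F_new ∈ ℝ, and set γ = α/(α + Γ). Let F^{(i)} be defined by the recursion F^{(0)}(t_0) = e^{−Γ t_0}(F_new − 1/4) + 1/4 and F^{(i)}(t_0,…,t_i) = e^{−Γ t_i}(a F^{(i−1)}(t_0,…,t_{i−1}) + b − 1/4) + 1/4. Then for every i ≥ 0, the iterated integral ∫_0^∞ ⋯ ∫_0^∞ F^{(i)}(t_0,…,t_i) ∏_{j=0}^{i} α e^{−α t_j} dt_0 ⋯ dt_i equals c_i = 1/4 + (F_new − 1/4) a^i γ^{i+1} + (a/4 + b − 1/4) γ (1 − a^i γ^i)/(1 − aγ). -/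
open MeasureTheory

section LastCoordinate

variable {n : ℕ} {ν : Measure ℝ} [SigmaFinite ν]

lemma integrable_mul_last_init {h : ℝ → ℝ} {k : (Fin n → ℝ) → ℝ} (hh : Integrable h ν)
    (hk : Integrable k (Measure.pi fun _ => ν)) :
    Integrable (fun t : Fin (n + 1) → ℝ => h (t (Fin.last n)) * k (Fin.init t))
      (Measure.pi fun _ => ν) := by
  have e := measurePreserving_piFinSuccAbove (fun _ : Fin (n + 1) => ν) (Fin.last n)
  have := e.integrable_comp_of_integrable (hh.mul_prod hk)
  simpa [Function.comp_def, MeasurableEquiv.piFinSuccAbove, Fin.insertNthEquiv] using this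

lemma integral_mul_last_init (h : ℝ → ℝ) (k : (Fin n → ℝ) → ℝ) :
    ∫ t : Fin (n + 1) → ℝ, h (t (Fin.last n)) * k (Fin.init t) ∂(Measure.pi fun _ => ν)
      = (∫ x, h x ∂ν) * ∫ t, k t ∂(Measure.pi fun _ => ν) := by
  have e := measurePreserving_piFinSuccAbove (fun _ : Fin (n + 1) => ν) (Fin.last n)
  have := e.integral_comp' (fun z => h z.1 * k z.2)
  rw [integral_prod_mul] at this
  simpa [MeasurableEquiv.piFinSuccAbove, Fin.insertNthEquiv] using this

end LastCoordinate

lemma integrableOn_exp_neg_mul_Ici {c : ℝ} (hc : 0 < c) :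
    IntegrableOn (fun x : ℝ => Real.exp (-c * x)) (Set.Ici 0) :=
  (integrableOn_Ici_iff_integrableOn_Ioi).2 (integrableOn_exp_mul_Ioi (neg_lt_zero.2 hc) 0)

lemma integral_exp_neg_mul_Ici {c : ℝ} (hc : 0 < c) :
    ∫ x in Set.Ici (0:ℝ), Real.exp (-c * x) = 1 / c := by
  rw [integral_Ici_eq_integral_Ioi, integral_exp_mul_Ioi (neg_lt_zero.2 hc)]
  simp

lemma integral_exp_density {α : ℝ} (hα : 0 < α) :
    ∫ x in Set.Ici (0:ℝ), α * Real.exp (-α * x) = 1 := by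
  rw [integral_const_mul, integral_exp_neg_mul_Ici hα, mul_one_div_cancel hα.ne']

lemma integrable_prod_exp_density {α : ℝ} (hα : 0 < α) (n : ℕ) :
    Integrable (fun t : Fin n → ℝ => ∏ j, α * Real.exp (-α * t j))
      (Measure.pi fun _ => volume.restrict (Set.Ici (0:ℝ))) :=
  Integrable.fintype_prod (f := fun _ x => α * Real.exp (-α * x))
    fun _ => (integrableOn_exp_neg_mul_Ici hα).const_mul α

lemma integral_prod_exp_density {α : ℝ} (hα : 0 < α) (n : ℕ) :
    ∫ t : Fin n → ℝ, ∏ j, α * Real.exp (-α * t j)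
      ∂(Measure.pi fun _ => volume.restrict (Set.Ici (0:ℝ))) = 1 := by
  rw [integral_fintype_prod_eq_prod (fun _ x => α * Real.exp (-α * x))]
  simp only [integral_exp_density hα, Finset.prod_const_one]

/-- One round of decay towards `1/4`, averaged over a further exponential holding time. -/
lemma integrable_and_integral_decay {Γ α : ℝ} (hΓ : 0 < Γ) (hα : 0 < α) {n : ℕ}
    {G : (Fin n → ℝ) → ℝ} {H : (Fin (n + 1) → ℝ) → ℝ}
    (hH : ∀ t, H t = Real.exp (-Γ * t (Fin.last n)) * (G (Fin.init t) - 1/4) + 1/4)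
    (hG : Integrable (fun t => G t * ∏ j, α * Real.exp (-α * t j))
      (Measure.pi fun _ => volume.restrict (Set.Ici (0:ℝ)))) :
    Integrable (fun t => H t * ∏ j, α * Real.exp (-α * t j))
      (Measure.pi fun _ => volume.restrict (Set.Ici (0:ℝ))) ∧
    ∫ t, H t * ∏ j, α * Real.exp (-α * t j)
        ∂(Measure.pi fun _ => volume.restrict (Set.Ici (0:ℝ)))
      = α / (α + Γ) * ((∫ t, G t * ∏ j, α * Real.exp (-α * t j)
        ∂(Measure.pi fun _ => volume.restrict (Set.Ici (0:ℝ)))) - 1/4) + 1/4 := by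
  have hs : 0 < α + Γ := by positivity
  have hg := (integrableOn_exp_neg_mul_Ici hα).const_mul α
  have hg' := (integrableOn_exp_neg_mul_Ici hs).const_mul α
  have ig := integral_exp_density hα
  have ig' : ∫ x in Set.Ici (0:ℝ), α * Real.exp (-(α + Γ) * x) = α / (α + Γ) := by
    rw [integral_const_mul, integral_exp_neg_mul_Ici hs, mul_one_div]
  have hW := integrable_prod_exp_density hα n
  have iW := integral_prod_exp_density hα n
  have hK := hG.sub (hW.const_mul (1/4))
  have key : (fun t : Fin (n + 1) → ℝ => H t * ∏ j, α * Real.exp (-α * t j)) = fun t =>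
      α * Real.exp (-(α + Γ) * t (Fin.last n)) *
        (G (Fin.init t) * ∏ j, α * Real.exp (-α * Fin.init t j)
          - 1/4 * ∏ j, α * Real.exp (-α * Fin.init t j))
      + α * Real.exp (-α * t (Fin.last n)) *
        (1/4 * ∏ j, α * Real.exp (-α * Fin.init t j)) := by
    ext t
    rw [hH, Fin.prod_univ_castSucc,
      show -(α + Γ) * t (Fin.last n) = -Γ * t (Fin.last n) + -α * t (Fin.last n) by ring,
      Real.exp_add]
    simp only [Fin.init]
    ring
  have h₁ := integrable_mul_last_init hg' hK
  have h₂ := integrable_mul_last_init hg (hW.const_mul (1/4))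
  have i₁ := integral_mul_last_init (ν := volume.restrict (Set.Ici (0:ℝ)))
    (fun x => α * Real.exp (-(α + Γ) * x))
    (fun t : Fin n → ℝ => G t * ∏ j, α * Real.exp (-α * t j)
      - 1/4 * ∏ j, α * Real.exp (-α * t j))
  have i₂ := integral_mul_last_init (ν := volume.restrict (Set.Ici (0:ℝ)))
    (fun x => α * Real.exp (-α * x))
    (fun t : Fin n → ℝ => 1/4 * ∏ j, α * Real.exp (-α * t j))
  rw [integral_sub hG (hW.const_mul (1/4)), ig', integral_const_mul, iW] at i₁
  rw [ig, integral_const_mul, iW] at i₂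
  rw [key]
  refine ⟨h₁.add h₂, (integral_add h₁ h₂).trans ?_⟩
  simp only [Pi.sub_apply]
  rw [i₁, i₂]
  ring

/-- **Expected fidelity after `i` purification rounds.**
Averaging `F⁽ⁱ⁾` over `i+1` i.i.d. exponential holding times (rate `α`) gives
`c_i = 1/4 + (F_new − 1/4) aⁱ γ^{i+1} + (a/4 + b − 1/4) γ (1 − aⁱγⁱ)/(1 − aγ)`,
where `γ = α/(α + Γ)`. -/
theorem stmt_3 (Γ α a b Fnew : ℝ) (hΓ : 0 < Γ) (hα : 0 < α)
    (ha : a ∈ Set.Icc (0:ℝ) 1)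
    (γ : ℝ) (hγ : γ = α / (α + Γ))
    (FF : (i : ℕ) → (Fin (i + 1) → ℝ) → ℝ)
    (h0 : ∀ t : Fin 1 → ℝ, FF 0 t = Real.exp (-Γ * t 0) * (Fnew - 1/4) + 1/4)
    (hrec : ∀ (i : ℕ) (t : Fin (i + 2) → ℝ),
      FF (i + 1) t
        = Real.exp (-Γ * t (Fin.last (i + 1))) * (a * FF i (Fin.init t) + b - 1/4) + 1/4) :
    ∀ i : ℕ,
      (∫ t in Set.univ.pi (fun _ : Fin (i + 1) => Set.Ici (0:ℝ)),
          FF i t * ∏ j : Fin (i + 1), α * Real.exp (-α * t j))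
        = 1/4 + (Fnew - 1/4) * a ^ i * γ ^ (i + 1)
          + (a/4 + b - 1/4) * γ * (1 - a ^ i * γ ^ i) / (1 - a * γ) := by
  have hdom (n : ℕ) : (volume : Measure (Fin n → ℝ)).restrict
      (Set.univ.pi fun _ => Set.Ici (0:ℝ))
        = Measure.pi fun _ => volume.restrict (Set.Ici (0:ℝ)) := by
    rw [volume_pi, Measure.restrict_pi_pi]
  have hγ1 : γ < 1 := by
    rw [hγ, div_lt_one (by positivity)]
    linarith
  have hγ0 : 0 < γ := hγ ▸ by positivity
  have hne : 1 - a * γ ≠ 0 := by nlinarith [ha.1, ha.2]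
  intro i
  rw [hdom]
  suffices h : Integrable (fun t => FF i t * ∏ j, α * Real.exp (-α * t j))
      (Measure.pi fun _ => volume.restrict (Set.Ici (0:ℝ))) ∧ _ from h.2
  induction i with
  | zero =>
    obtain ⟨hi, he⟩ := integrable_and_integral_decay hΓ hα (n := 0) (G := fun _ => Fnew)
      (H := FF 0) h0 (by simp)
    refine ⟨hi, he.trans ?_⟩
    simp [hγ, measureReal_def]
    ring
  | succ i ih =>
    have hW := integrable_prod_exp_density hα (i + 1)
    have iW := integral_prod_exp_density hα (i + 1)
    have hsplit : (fun t => (a * FF i t + b) * ∏ j, α * Real.exp (-α * t j)) = fun t =>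
        a * (FF i t * ∏ j, α * Real.exp (-α * t j)) + b * ∏ j, α * Real.exp (-α * t j) := by
      ext t
      ring
    obtain ⟨hi, he⟩ := integrable_and_integral_decay hΓ hα (G := fun t => a * FF i t + b)
      (H := FF (i + 1)) (hrec i) (by
        rw [hsplit]
        exact (ih.1.const_mul a).add (hW.const_mul b))
    refine ⟨hi, he.trans ?_⟩
    rw [hsplit, integral_add (ih.1.const_mul a) (hW.const_mul b), integral_const_mul,
      integral_const_mul, ih.2, iW, ← hγ]
    linear_combination (-(γ * (a/4 + b - 1/4))) * mul_inv_cancel₀ hne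
end

section
/- Fix λ, μ > 0, p, q ∈ [0,1], Γ ≥ 0, a ∈ [0,1], b, F_new ∈ ℝ, with either Γ > 0 or a < 1. Set α = μ + λq, γ = α/(α+Γ), π_∅ = (μ + λq(1−p))/(λ + μ + λq(1−p)), π_i = (λ^{i+1} q^i p^i / (μ + λq)^{i+1}) π_∅, and c_i = 1/4 + (F_new − 1/4) a^i γ^{i+1} + (a/4 + b − 1/4) γ (1 − a^i γ^i)/(1 − aγ). Then (1/(1 − π_∅)) ∑_{i=0}^∞ c_i π_i = (Γ/4 + bλqp + F_new(μ + λq(1−p))) / (Γ + μ + λq(1 − pa)). -/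
/-- The mean of `A + B * s ^ i` under the geometric distribution with ratio `r`. -/
theorem hasSum_affine_pow_mul_geometric {r s : ℝ} (hr₀ : 0 ≤ r) (hr₁ : r < 1)
    (hs₀ : 0 ≤ s) (hs₁ : s < 1) (A B : ℝ) :
    HasSum (fun i : ℕ => (A + B * s ^ i) * ((1 - r) * r ^ i))
      (A + B * (1 - r) / (1 - s * r)) := by
  have hsr : s * r < 1 := mul_lt_one_of_nonneg_of_lt_one_left hs₀ hs₁ hr₁.le
  have h₁ := (hasSum_geometric_of_lt_one hr₀ hr₁).mul_left (A * (1 - r))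
  have h₂ := (hasSum_geometric_of_lt_one (mul_nonneg hs₀ hr₀) hsr).mul_left (B * (1 - r))
  have hr : 1 - r ≠ 0 := by linarith
  rw [mul_inv_cancel_right₀ hr] at h₁
  rw [← div_eq_mul_inv] at h₂
  have hfun : (fun i : ℕ => (A + B * s ^ i) * ((1 - r) * r ^ i)) =
      fun i => A * (1 - r) * r ^ i + B * (1 - r) * (s * r) ^ i := by
    funext i
    rw [mul_pow]
    ring
  rw [hfun]
  exact h₁.add h₂

/-- **Closed form for the average consumed fidelity (linear jump function).**
With the stationary distribution `π` of the 1G1B chain and the expected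
fidelities `c_i`, the average consumed fidelity
`(1/(1−π_∅)) ∑_i c_i π_i` equals
`(Γ/4 + bλqp + F_new(μ + λq(1−p))) / (Γ + μ + λq(1 − pa))`. -/
theorem stmt_4 (lam mu p q Γ a b Fnew : ℝ) (hlam : 0 < lam) (hmu : 0 < mu)
    (hp : p ∈ Set.Icc (0:ℝ) 1) (hq : q ∈ Set.Icc (0:ℝ) 1)
    (hΓ : 0 ≤ Γ) (ha : a ∈ Set.Icc (0:ℝ) 1) (hconv : 0 < Γ ∨ a < 1)
    (α γ piE : ℝ) (pii c : ℕ → ℝ)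
    (hα : α = mu + lam * q) (hγ : γ = α / (α + Γ))
    (hpiE : piE = (mu + lam * q * (1 - p)) / (lam + mu + lam * q * (1 - p)))
    (hpii : ∀ i : ℕ, pii i = lam ^ (i + 1) * q ^ i * p ^ i / (mu + lam * q) ^ (i + 1) * piE)
    (hc : ∀ i : ℕ, c i = 1/4 + (Fnew - 1/4) * a ^ i * γ ^ (i + 1)
        + (a/4 + b - 1/4) * γ * (1 - a ^ i * γ ^ i) / (1 - a * γ)) :
    (1 / (1 - piE)) * ∑' i : ℕ, c i * pii i
      = (Γ/4 + b * lam * q * p + Fnew * (mu + lam * q * (1 - p)))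
        / (Γ + mu + lam * q * (1 - p * a)) := by
  obtain ⟨hp₀, hp₁⟩ := hp
  obtain ⟨hq₀, hq₁⟩ := hq
  obtain ⟨ha₀, ha₁⟩ := ha
  have hlq : 0 ≤ lam * q := by positivity
  have hαpos : 0 < α := by rw [hα]; positivity
  have hαΓ : 0 < α + Γ := by positivity
  have hlqp : lam * q * p ≤ lam * q := mul_le_of_le_one_right hlq hp₁
  have hm : 0 < mu + lam * q * (1 - p) := by linarith
  have hlm : 0 < lam + mu + lam * q * (1 - p) := by linarith
  have haα : a * α < α + Γ := by
    rcases hconv with h | h <;> nlinarith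
  have hγ₀ : 0 ≤ γ := by rw [hγ]; positivity
  have hs₁ : a * γ < 1 := by
    rw [hγ, ← mul_div_assoc, div_lt_one hαΓ]
    exact haα
  have hr₀ : 0 ≤ lam * q * p / α := by positivity
  have hr₁ : lam * q * p / α < 1 := by
    rw [div_lt_one hαpos]
    linarith
  have hsr : a * γ * (lam * q * p / α) < 1 :=
    mul_lt_one_of_nonneg_of_lt_one_left (mul_nonneg ha₀ hγ₀) hs₁ hr₁.le
  have hs' : 1 - a * γ ≠ 0 := by linarith
  have hsr' : 1 - a * γ * (lam * q * p / α) ≠ 0 := by linarith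
  have hden : Γ + mu + lam * q * (1 - p * a) ≠ 0 := by
    have : lam * q * p * a ≤ lam * q * p := mul_le_of_le_one_right (by positivity) ha₁
    nlinarith
  have hweight : 1 / (1 - piE) * piE * lam = α * (1 - lam * q * p / α) := by
    have h₁ : 1 - piE = lam / (lam + mu + lam * q * (1 - p)) := by
      rw [hpiE]
      field_simp
      ring
    have h₂ : α * (1 - lam * q * p / α) = mu + lam * q * (1 - p) := by
      field_simp
      rw [hα]
      ring
    rw [h₁, h₂, hpiE]
    field_simp
  have hterm : ∀ i : ℕ, 1 / (1 - piE) * (c i * pii i) =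
      ((1 / 4 + (a / 4 + b - 1 / 4) * γ / (1 - a * γ)) +
        ((Fnew - 1 / 4) * γ - (a / 4 + b - 1 / 4) * γ / (1 - a * γ)) * (a * γ) ^ i) *
      ((1 - lam * q * p / α) * (lam * q * p / α) ^ i) := by
    intro i
    have hπ : 1 / (1 - piE) * pii i =
        (1 - lam * q * p / α) * (lam * q * p / α) ^ i := by
      calc 1 / (1 - piE) * pii i
          = 1 / (1 - piE) * piE * lam * ((lam * q * p) ^ i / α ^ (i + 1)) := by
            rw [hpii, ← hα, mul_pow, mul_pow]
            ring
        _ = _ := by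
            rw [hweight, div_pow, pow_succ]
            field_simp
    rw [mul_left_comm, hπ, hc, mul_pow]
    ring
  rw [← tsum_mul_left, tsum_congr hterm,
    (hasSum_affine_pow_mul_geometric hr₀ hr₁ (mul_nonneg ha₀ hγ₀) hs₁ _ _).tsum_eq]
  have hcombine : ∀ r : ℝ, 1 - a * γ * r ≠ 0 →
      1 / 4 + (a / 4 + b - 1 / 4) * γ / (1 - a * γ) +
        ((Fnew - 1 / 4) * γ - (a / 4 + b - 1 / 4) * γ / (1 - a * γ)) * (1 - r) /
          (1 - a * γ * r) =
      ((1 - γ) / 4 + b * γ * r + Fnew * γ * (1 - r)) / (1 - a * γ * r) := by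
    intro r hr
    field_simp
    ring
  rw [hcombine _ hsr', div_eq_div_iff hsr' hden, hγ]
  have hmu' : mu = α - lam * q := by linarith
  rw [hmu']
  field_simp
  ring
end

section
/- Fix λ, μ > 0, p ∈ [0,1], Γ ≥ 0, a ∈ [0,1], F_new ∈ [1/4, 1], and b ∈ ℝ with b ≥ (1−a)/4. If b ≥ F_new(1−a), then the function F̄(q) = (Γ/4 + bλqp + F_new(μ + λq(1−p))) / (Γ + μ + λq(1 − pa)) is nondecreasing on q ∈ [0,1]. -/
/-- **A good enough pumping protocol makes `F̄` nondecreasing in `q`.**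
If the linear jump function `J(F) = aF + b` satisfies `b ≥ (1−a)/4` and
`b ≥ F_new(1−a)`, then the average consumed fidelity `F̄(q)` is nondecreasing
on `q ∈ [0,1]`. -/
theorem stmt_7 (lam mu p Γ a b Fnew : ℝ) (hlam : 0 < lam) (hmu : 0 < mu)
    (hp : p ∈ Set.Icc (0:ℝ) 1) (hΓ : 0 ≤ Γ) (ha : a ∈ Set.Icc (0:ℝ) 1)
    (hFnew : Fnew ∈ Set.Icc (1/4 : ℝ) 1)
    (hb : (1 - a) / 4 ≤ b) (hgood : Fnew * (1 - a) ≤ b)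
    (Fbar : ℝ → ℝ)
    (hF : ∀ q : ℝ, Fbar q = (Γ/4 + b * lam * q * p + Fnew * (mu + lam * q * (1 - p)))
        / (Γ + mu + lam * q * (1 - p * a))) :
    MonotoneOn Fbar (Set.Icc 0 1) := by
  obtain ⟨hp0, hp1⟩ := hp
  have hpa : 0 ≤ 1 - p * a := sub_nonneg.2 (mul_le_one₀ hp1 ha.1 ha.2)
  have hden : ∀ q : ℝ, 0 ≤ q → 0 < Γ + mu + lam * q * (1 - p * a) := fun q hq => by
    positivity
  intro x hx y hy hxy
  rw [hF, hF, div_le_div_iff₀ (hden x hx.1) (hden y hy.1)]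
  have hdecay : 0 ≤ Γ * (p * (b - (1 - a) / 4) + (1 - p) * (Fnew - 1 / 4)) :=
    mul_nonneg hΓ (add_nonneg (mul_nonneg hp0 (sub_nonneg.2 hb))
      (mul_nonneg (sub_nonneg.2 hp1) (sub_nonneg.2 hFnew.1)))
  have hpump : 0 ≤ mu * (p * (b - Fnew * (1 - a))) :=
    mul_nonneg hmu.le (mul_nonneg hp0 (sub_nonneg.2 hgood))
  linear_combination
    mul_nonneg (mul_nonneg hlam.le (sub_nonneg.2 hxy)) (add_nonneg hdecay hpump)
end

section
/- Fix λ, μ > 0, p ∈ (0,1], Γ ≥ 0, a ∈ [0,1], F_new ∈ (1/4, 1], and b ∈ ℝ with b ≥ (1−a)/4, and suppose y := 4F_new(1−p) + (4b+a)p − 1 > 0. If Γ > 4μp(F_new(1−a) − b) / y, then the function F̄(q) = (Γ/4 + bλqp + F_new(μ + λq(1−p))) / (Γ + μ + λq(1 − pa)) is strictly increasing on q ∈ [0,1]. -/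
/-- **Noise threshold above which any pumping is better than no pumping.**
With `y = 4F_new(1−p) + (4b+a)p − 1 > 0`, if the decoherence rate satisfies
`Γ > 4μp(F_new(1−a) − b)/y`, then the average consumed fidelity `F̄(q)` is
strictly increasing on `q ∈ [0,1]`. -/
theorem stmt_8 (lam mu p Γ a b Fnew : ℝ) (hlam : 0 < lam) (hmu : 0 < mu)
    (hp : p ∈ Set.Ioc (0:ℝ) 1) (hΓ : 0 ≤ Γ) (ha : a ∈ Set.Icc (0:ℝ) 1)
    (hFnew : Fnew ∈ Set.Ioc (1/4 : ℝ) 1)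
    (hb : (1 - a) / 4 ≤ b)
    (y : ℝ) (hy : y = 4 * Fnew * (1 - p) + (4 * b + a) * p - 1) (hypos : 0 < y)
    (hthresh : 4 * mu * p * (Fnew * (1 - a) - b) / y < Γ)
    (Fbar : ℝ → ℝ)
    (hF : ∀ q : ℝ, Fbar q = (Γ/4 + b * lam * q * p + Fnew * (mu + lam * q * (1 - p)))
        / (Γ + mu + lam * q * (1 - p * a))) :
    StrictMonoOn Fbar (Set.Icc 0 1) := by
  rw [div_lt_iff₀ hypos] at hthresh
  have hpa : 0 ≤ 1 - p * a := by nlinarith [hp.1, hp.2, ha.1, ha.2]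
  have hden : ∀ q ∈ Set.Icc (0:ℝ) 1, 0 < Γ + mu + lam * q * (1 - p * a) := fun q hq => by
    have := mul_nonneg (mul_nonneg hlam.le hq.1) hpa
    linarith
  intro q hq r hr hqr
  rw [hF q, hF r, div_lt_div_iff₀ (hden q hq) (hden r hr)]
  have hgap : 0 < lam * (r - q) * (Γ * y - 4 * mu * p * (Fnew * (1 - a) - b)) :=
    mul_pos (mul_pos hlam (sub_pos.2 hqr)) (sub_pos.2 hthresh)
  subst hy
  linarith
end

section
/- Let F_BD ∈ (1/2, 1] and λ₁, λ₂, λ₃ ≥ 0 with F_BD + λ₁ + λ₂ + λ₃ = 1. For i ∈ {1,2,3} define J_i(F) = ((3F_BD − λ_i)F + λ_i) / ((4F_BD + 4λ_i − 2)F + 2 − F_BD − λ_i). Then for every i ∈ {1,2,3} and every F ∈ [1/4, 1], J_i(F) ≤ (4(1 − F_BD)/3) F + (4F_BD − 1)/3. -/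
/-- The denominator of the jump function is positive on `[1/4, 1]`. -/
lemma jump_denom_pos {a l F : ℝ} (ha : 1 / 2 < a) (hl : 0 ≤ l) (hF : 1 / 4 ≤ F) :
    0 < (4 * a + 4 * l - 2) * F + 2 - a - l := by
  nlinarith [mul_nonneg (by linarith : 0 ≤ 4 * a + 4 * l - 2) (sub_nonneg.2 hF)]

/-- The linear bound on the jump function with its denominator cleared. Both sides are affine
in `l`, so the inequality follows from the cases `l = 0` and `l = 1 - a`. -/
lemma jump_num_le {a l F : ℝ} (ha : 1 / 2 < a) (hl : 0 ≤ l) (hal : a + l ≤ 1)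
    (hF : 1 / 4 ≤ F) (hF1 : F ≤ 1) :
    (3 * a - l) * F + l ≤
      ((4 * (1 - a) / 3) * F + (4 * a - 1) / 3) * ((4 * a + 4 * l - 2) * F + 2 - a - l) := by
  obtain ⟨t, rfl⟩ : ∃ t, F = 1 / 4 + 3 / 4 * t := ⟨(4 * F - 1) / 3, by ring⟩
  have ht : 0 ≤ t := by linarith
  have ht1 : 0 ≤ 1 - t := by linarith
  have hb : 0 ≤ 1 - a := by linarith
  have left_end : 0 ≤ (1 - t) * (a - (1 - a) * (4 * a - 2) * t) := by
    refine mul_nonneg ht1 ?_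
    have := mul_nonneg (mul_nonneg hb (by linarith : 0 ≤ 4 * a - 2)) ht1
    nlinarith [sq_nonneg (8 * a - 5)]
  have right_end : 0 ≤ (2 * a - 1) * (1 - t) + 2 * (1 - a) * t + 2 * (1 - a) * t ^ 2 := by
    have : 0 ≤ 2 * a - 1 := by linarith
    positivity
  rcases hb.eq_or_lt with h | h
  · obtain rfl : a = 1 := by linarith
    obtain rfl : l = 0 := by linarith
    linarith
  · rw [← sub_nonneg]
    refine nonneg_of_mul_nonneg_right ?_ h
    have h0 := mul_nonneg (by linarith : 0 ≤ 1 - a - l) left_end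
    have h1 := mul_nonneg hl right_end
    linarith

/-- **Linear upper bound on the jump functions of bilocal Clifford protocols.**
For a Bell-diagonal state with `F_BD ∈ (1/2, 1]`, `λ₁, λ₂, λ₃ ≥ 0` and
`F_BD + λ₁ + λ₂ + λ₃ = 1`, the line through `(1/4, F_BD)` and `(1, 1)` upper
bounds every nontrivial jump function `J_i` on `[1/4, 1]`. -/
theorem stmt_11 (FBD l1 l2 l3 : ℝ)
    (hFBD : FBD ∈ Set.Ioc (1/2 : ℝ) 1)
    (h1 : 0 ≤ l1) (h2 : 0 ≤ l2) (h3 : 0 ≤ l3)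
    (hsum : FBD + l1 + l2 + l3 = 1)
    (J : ℝ → ℝ → ℝ)
    (hJ : ∀ l F : ℝ, J l F
      = ((3 * FBD - l) * F + l) / ((4 * FBD + 4 * l - 2) * F + 2 - FBD - l)) :
    ∀ l ∈ ({l1, l2, l3} : Set ℝ), ∀ F ∈ Set.Icc (1/4 : ℝ) 1,
      J l F ≤ (4 * (1 - FBD) / 3) * F + (4 * FBD - 1) / 3 := by
  intro l hl F hF
  have hl' : 0 ≤ l ∧ FBD + l ≤ 1 := by
    rcases hl with rfl | rfl | rfl <;> constructor <;> linarith
  rw [hJ, div_le_iff₀ (jump_denom_pos hFBD.1 hl'.1 hF.1)]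
  exact jump_num_le hFBD.1 hl'.1 hl'.2 hF.1 hF.2
end

section
/- Let F_BD ∈ (1/2, 1] and λ₁, λ₂, λ₃ ≥ 0 with F_BD + λ₁ + λ₂ + λ₃ = 1, and let λ_max = max{λ₁, λ₂, λ₃}. For i ∈ {1,2,3} define p_i(F) = (2/3)(1 − 2λ_j − 2λ_k)F + (1/3)(1 + λ_j + λ_k), where {j,k} = {1,2,3} \ {i}. Then each p_i is strictly increasing on ℝ, and for every F ∈ [1/4, 1] one has 1/2 ≤ p_i(F) ≤ F_BD + λ_max. -/
/-- The affine map `F ↦ (2/3)(1 − 2u − 2v)F + (1/3)(1 + u + v)` is strictly increasing when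
`u + v < 1/2`, with values `1/2` at `1/4` and `1 - u - v` at `1`. -/
theorem successProbability_strictMono_and_bounds {f : ℝ → ℝ} {u v : ℝ} (huv : u + v < 1 / 2)
    (hf : ∀ F, f F = 2/3 * (1 - 2*u - 2*v) * F + 1/3 * (1 + u + v)) :
    StrictMono f ∧ ∀ F ∈ Set.Icc (1/4 : ℝ) 1, 1/2 ≤ f F ∧ f F ≤ 1 - u - v := by
  have hmono : StrictMono f := by
    intro a b hab
    rw [hf, hf]
    have hslope : 0 < 2/3 * (1 - 2*u - 2*v) := by linarith
    gcongr
  refine ⟨hmono, fun F hF => ⟨?_, ?_⟩⟩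
  · have h := hmono.monotone hF.1
    rw [hf (1/4)] at h
    linarith
  · have h := hmono.monotone hF.2
    rw [hf 1] at h
    linarith

/-- **Bounds on the success probabilities of bilocal Clifford protocols.**
For a Bell-diagonal state with `F_BD ∈ (1/2, 1]`, the success probabilities
`p_i(F) = (2/3)(1 − 2λ_j − 2λ_k)F + (1/3)(1 + λ_j + λ_k)` (with `{j,k}` the
complement of `{i}` in `{1,2,3}`) are strictly increasing, and on `[1/4, 1]`
satisfy `1/2 ≤ p_i(F) ≤ F_BD + λ_max`. -/
theorem stmt_12 (FBD l1 l2 l3 : ℝ)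
    (hFBD : FBD ∈ Set.Ioc (1/2 : ℝ) 1)
    (h1 : 0 ≤ l1) (h2 : 0 ≤ l2) (h3 : 0 ≤ l3)
    (hsum : FBD + l1 + l2 + l3 = 1)
    (lmax : ℝ) (hlmax : lmax = max l1 (max l2 l3))
    (pf : ℝ → ℝ → ℝ → ℝ)
    (hpf : ∀ u v F : ℝ, pf u v F = 2/3 * (1 - 2*u - 2*v) * F + 1/3 * (1 + u + v)) :
    ∀ uv ∈ ({(l2, l3), (l1, l3), (l1, l2)} : Set (ℝ × ℝ)),
      StrictMono (pf uv.1 uv.2) ∧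
      ∀ F ∈ Set.Icc (1/4 : ℝ) 1,
        1/2 ≤ pf uv.1 uv.2 F ∧ pf uv.1 uv.2 F ≤ FBD + lmax := by
  have hm1 : l1 ≤ lmax := hlmax ▸ le_max_left _ _
  have hm2 : l2 ≤ lmax := hlmax ▸ (le_max_left _ _).trans (le_max_right _ _)
  have hm3 : l3 ≤ lmax := hlmax ▸ (le_max_right _ _).trans (le_max_right _ _)
  have hF := hFBD.1
  intro uv huv
  obtain ⟨hlt, hle⟩ : uv.1 + uv.2 < 1 / 2 ∧ 1 - uv.1 - uv.2 ≤ FBD + lmax := by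
    rcases huv with rfl | rfl | rfl <;> constructor <;> dsimp only <;> linarith
  obtain ⟨hmono, hbounds⟩ := successProbability_strictMono_and_bounds hlt (hpf uv.1 uv.2)
  exact ⟨hmono, fun F hF => ⟨(hbounds F hF).1, (hbounds F hF).2.trans hle⟩⟩
end

section
/- Let F_BD ∈ (1/2, 1] and λ₁, λ₂, λ₃ ≥ 0 with F_BD + λ₁ + λ₂ + λ₃ = 1. For i ∈ {1,2,3} define J_i(F) = ((3F_BD − λ_i)F + λ_i) / ((4F_BD + 4λ_i − 2)F + 2 − F_BD − λ_i), and set F_int = (4F_BD − 2 + 3√(2F_BD)) / (2(8F_BD − 1)). Then F_int > 0, for every i ∈ {1,2,3} the denominator (4F_BD + 4λ_i − 2)F_int + 2 − F_BD − λ_i is nonzero and J_i(F_int) = √(F_BD/2), and moreover √(F_BD/2) < F_BD. -/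
/-- **Common intersection point of the three jump functions.**
For a Bell-diagonal state with `F_BD ∈ (1/2, 1]`, the point
`F_int = (4F_BD − 2 + 3√(2F_BD)) / (2(8F_BD − 1))` is positive, the
denominators of the `J_i` do not vanish there, `J_i(F_int) = √(F_BD/2)` for
each `i`, and `√(F_BD/2) < F_BD`. -/
theorem stmt_13 (FBD l1 l2 l3 : ℝ)
    (hFBD : FBD ∈ Set.Ioc (1/2 : ℝ) 1)
    (h1 : 0 ≤ l1) (h2 : 0 ≤ l2) (h3 : 0 ≤ l3)
    (hsum : FBD + l1 + l2 + l3 = 1)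
    (J : ℝ → ℝ → ℝ)
    (hJ : ∀ l F : ℝ, J l F
      = ((3 * FBD - l) * F + l) / ((4 * FBD + 4 * l - 2) * F + 2 - FBD - l))
    (Fint : ℝ)
    (hFint : Fint = (4 * FBD - 2 + 3 * Real.sqrt (2 * FBD)) / (2 * (8 * FBD - 1))) :
    0 < Fint ∧
    (∀ l ∈ ({l1, l2, l3} : Set ℝ),
      (4 * FBD + 4 * l - 2) * Fint + 2 - FBD - l ≠ 0 ∧
      J l Fint = Real.sqrt (FBD / 2)) ∧
    Real.sqrt (FBD / 2) < FBD := by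
  obtain ⟨hF, -⟩ := hFBD
  set s := Real.sqrt (FBD / 2) with hs
  have hsq : s ^ 2 = FBD / 2 := Real.sq_sqrt (by linarith)
  have hs_half : 1 / 2 < s := Real.lt_sqrt_of_sq_lt (by linarith)
  have hFs : FBD = 2 * s ^ 2 := by linarith
  have hsqrt : Real.sqrt (2 * FBD) = 2 * s := by
    rw [hFs, show 2 * (2 * s ^ 2) = (2 * s) ^ 2 by ring, Real.sqrt_sq (by linarith)]
  have hFint' : Fint = (s + 1) / (4 * s + 1) := by
    rw [hFint, hsqrt, hFs, div_eq_div_iff (by nlinarith) (by linarith)]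
    ring
  have hs4 : 4 * s + 1 ≠ 0 := by linarith
  refine ⟨?_, fun l hl => ?_, by nlinarith⟩
  · rw [hFint']
    exact div_pos (by linarith) (by linarith)
  have hl0 : 0 ≤ l := by
    rcases hl with rfl | rfl | rfl <;> assumption
  have hden : (4 * FBD + 4 * l - 2) * Fint + 2 - FBD - l
      = (6 * s ^ 2 + 6 * s + 3 * l) / (4 * s + 1) := by
    rw [hFint', hFs]
    field_simp
    ring
  have hden_ne : (4 * FBD + 4 * l - 2) * Fint + 2 - FBD - l ≠ 0 := by
    rw [hden]
    exact (div_pos (by nlinarith) (by linarith)).ne'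
  refine ⟨hden_ne, ?_⟩
  rw [hJ, div_eq_iff hden_ne, hden, hFint', hFs]
  field_simp
  ring
end

section
/- Let F_BD ∈ (1/2, 1] and λ₁ ≥ λ₂ ≥ λ₃ ≥ 0 with F_BD + λ₁ + λ₂ + λ₃ = 1. For i ∈ {1,2,3} define J_i(F) = ((3F_BD − λ_i)F + λ_i) / ((4F_BD + 4λ_i − 2)F + 2 − F_BD − λ_i), and set F_int = (4F_BD − 2 + 3√(2F_BD)) / (2(8F_BD − 1)). Then for every F ∈ [F_int, 1], J_1(F) ≤ J_2(F) ≤ J_3(F). -/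
/-- For `F` nonnegative, the denominator of a jump function is positive. -/
theorem jump_denominator_pos {B l F : ℝ} (hB : 1 / 2 < B) (hl : 0 ≤ l) (hBl : B + l ≤ 1)
    (hF0 : 0 ≤ F) :
    0 < (4 * B + 4 * l - 2) * F + 2 - B - l := by
  nlinarith [mul_nonneg hF0 (by linarith : 0 ≤ 4 * B + 4 * l - 2)]

/-- To the right of the intersection point, the jump functions decrease in the coefficient. -/
theorem jump_le_jump {B l m F : ℝ} (hlm : m ≤ l)
    (hl : 0 < (4 * B + 4 * l - 2) * F + 2 - B - l)
    (hm : 0 < (4 * B + 4 * m - 2) * F + 2 - B - m)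
    (hQ : 0 ≤ 2 * (8 * B - 1) * F ^ 2 - (8 * B - 4) * F - (2 - B)) :
    ((3 * B - l) * F + l) / ((4 * B + 4 * l - 2) * F + 2 - B - l) ≤
      ((3 * B - m) * F + m) / ((4 * B + 4 * m - 2) * F + 2 - B - m) := by
  rw [div_le_div_iff₀ hl hm]
  linarith [mul_nonneg (sub_nonneg.mpr hlm) hQ]

/-- **Ordering of the jump functions beyond the intersection point.**
With `λ₁ ≥ λ₂ ≥ λ₃ ≥ 0`, on `[F_int, 1]` the jump functions satisfy
`J₁(F) ≤ J₂(F) ≤ J₃(F)`. -/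
theorem stmt_14 (FBD l1 l2 l3 : ℝ)
    (hFBD : FBD ∈ Set.Ioc (1/2 : ℝ) 1)
    (h12 : l2 ≤ l1) (h23 : l3 ≤ l2) (h3 : 0 ≤ l3)
    (hsum : FBD + l1 + l2 + l3 = 1)
    (J : ℝ → ℝ → ℝ)
    (hJ : ∀ l F : ℝ, J l F
      = ((3 * FBD - l) * F + l) / ((4 * FBD + 4 * l - 2) * F + 2 - FBD - l))
    (Fint : ℝ)
    (hFint : Fint = (4 * FBD - 2 + 3 * Real.sqrt (2 * FBD)) / (2 * (8 * FBD - 1))) :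
    ∀ F ∈ Set.Icc Fint 1, J l1 F ≤ J l2 F ∧ J l2 F ≤ J l3 F := by
  rintro F ⟨hF, -⟩
  obtain ⟨hB, -⟩ := hFBD
  have hA : 0 < 2 * (8 * FBD - 1) := by linarith
  have hs : 0 ≤ Real.sqrt (2 * FBD) := Real.sqrt_nonneg _
  have hs2 : Real.sqrt (2 * FBD) ^ 2 = 2 * FBD := Real.sq_sqrt (by linarith)
  rw [hFint, div_le_iff₀ hA] at hF
  have hF0 : 0 ≤ F := by
    by_contra! h
    linarith [mul_neg_of_neg_of_pos h hA]
  have hQ : 0 ≤ 2 * (8 * FBD - 1) * F ^ 2 - (8 * FBD - 4) * F - (2 - FBD) := by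
    have hsq : (3 * Real.sqrt (2 * FBD)) ^ 2 ≤
        (F * (2 * (8 * FBD - 1)) - (4 * FBD - 2)) ^ 2 :=
      pow_le_pow_left₀ (by linarith) (by linarith) 2
    refine nonneg_of_mul_nonneg_right ?_ hA
    rw [mul_pow, hs2] at hsq
    linarith
  have hd : ∀ l, 0 ≤ l → FBD + l ≤ 1 → 0 < (4 * FBD + 4 * l - 2) * F + 2 - FBD - l :=
    fun l hl hBl => jump_denominator_pos hB hl hBl hF0
  have hd1 := hd l1 (by linarith) (by linarith)
  have hd2 := hd l2 (by linarith) (by linarith)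
  have hd3 := hd l3 h3 (by linarith)
  simp only [hJ]
  exact ⟨jump_le_jump h12 hd1 hd2 hQ, jump_le_jump h23 hd2 hd3 hQ⟩
end

section
/- Let F_BD ∈ (1/2, 1] and λ ≥ 0 with F_BD + λ ≤ 1. Define F* = (2F_BD − 1 + √((2F_BD − 1)² + 2λ(2F_BD − 1 + 2λ))) / (2(2F_BD − 1 + 2λ)). Then F* > 0 and F* is a root of the quadratic (2 − 4F_BD − 4λ)F² + (4F_BD − 2)F + λ = 0; equivalently, F* is a fixed point of the jump function J(F) = ((3F_BD − λ)F + λ) / ((4F_BD + 4λ − 2)F + 2 − F_BD − λ), i.e. J(F*) = F*. Moreover F* is the unique positive root of this quadratic. -/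
/-- **Maximum fidelity `F*` as the unique positive fixed point of the jump
function.** For `F_BD ∈ (1/2, 1]`, `λ ≥ 0`, `F_BD + λ ≤ 1`, the value `F*` is
positive, is a root of `(2 − 4F_BD − 4λ)F² + (4F_BD − 2)F + λ`, is a fixed
point of `J`, and is the unique positive root of that quadratic. -/
theorem stmt_15 (FBD l : ℝ)
    (hFBD : FBD ∈ Set.Ioc (1/2 : ℝ) 1) (hl : 0 ≤ l) (hsum : FBD + l ≤ 1)
    (J : ℝ → ℝ)
    (hJ : ∀ F : ℝ, J F
      = ((3 * FBD - l) * F + l) / ((4 * FBD + 4 * l - 2) * F + 2 - FBD - l))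
    (Fstar : ℝ)
    (hFstar : Fstar = (2 * FBD - 1
        + Real.sqrt ((2 * FBD - 1) ^ 2 + 2 * l * (2 * FBD - 1 + 2 * l)))
        / (2 * (2 * FBD - 1 + 2 * l))) :
    0 < Fstar ∧
    (2 - 4 * FBD - 4 * l) * Fstar ^ 2 + (4 * FBD - 2) * Fstar + l = 0 ∧
    J Fstar = Fstar ∧
    (∀ x : ℝ, 0 < x →
      (2 - 4 * FBD - 4 * l) * x ^ 2 + (4 * FBD - 2) * x + l = 0 → x = Fstar) := by
  obtain ⟨hF, -⟩ := hFBD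
  have ha : 0 < 2 * FBD - 1 := by linarith
  have hc : 0 < 2 * FBD - 1 + 2 * l := by linarith
  have hD : 0 ≤ (2 * FBD - 1) ^ 2 + 2 * l * (2 * FBD - 1 + 2 * l) := by positivity
  set s := Real.sqrt ((2 * FBD - 1) ^ 2 + 2 * l * (2 * FBD - 1 + 2 * l))
  have hs : s ^ 2 = (2 * FBD - 1) ^ 2 + 2 * l * (2 * FBD - 1 + 2 * l) := Real.sq_sqrt hD
  have has : 2 * FBD - 1 ≤ s := Real.le_sqrt_of_sq_le (le_add_of_nonneg_right (by positivity))
  have hpos : 0 < Fstar := by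
    rw [hFstar]
    exact div_pos (by linarith) (by linarith)
  have hmul : 2 * (2 * FBD - 1 + 2 * l) * Fstar = 2 * FBD - 1 + s := by
    rw [hFstar]
    field_simp
  have hroot : (2 - 4 * FBD - 4 * l) * Fstar ^ 2 + (4 * FBD - 2) * Fstar + l = 0 := by
    apply mul_left_cancel₀ hc.ne'
    have hsq : (2 * (2 * FBD - 1 + 2 * l) * Fstar - (2 * FBD - 1)) ^ 2 = s ^ 2 := by
      rw [hmul]
      ring
    linear_combination (-1 / 2) * hsq - (1 / 2) * hs
  refine ⟨hpos, hroot, ?_, fun x hx hxroot => ?_⟩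
  · have hden : 0 < (4 * FBD + 4 * l - 2) * Fstar + 2 - FBD - l := by
      have : 0 < (4 * FBD + 4 * l - 2) * Fstar := mul_pos (by linarith) hpos
      linarith
    rw [hJ, div_eq_iff hden.ne']
    linear_combination hroot
  · have hfactor : (x - Fstar) *
        (2 * (2 * FBD - 1 + 2 * l) * x + (s - (2 * FBD - 1))) = 0 := by
      linear_combination hroot - hxroot - (x - Fstar) * hmul
    have hne : 2 * (2 * FBD - 1 + 2 * l) * x + (s - (2 * FBD - 1)) ≠ 0 := by
      have := mul_pos hc hx
      linarith
    exact sub_eq_zero.mp ((mul_eq_zero.mp hfactor).resolve_right hne)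
end

section
/- Let F_BD ∈ (1/2, 1] and λ₃ ∈ [0, (1 − F_BD)/3]. Define J_tan(F) = (2F_BD / (3(F_BD + λ₃)²) − 1/3)(F − 1) + F_BD/(F_BD + λ₃) and J_UB(F) = (4(1 − F_BD)/3) F + (4F_BD − 1)/3. Then for every F ∈ [1/4, 1], J_tan(F) ≤ J_UB(F). -/
/-- **The tangent line lies below the linear upper bound.**
For `F_BD ∈ (1/2, 1]` and `λ₃ ∈ [0, (1 − F_BD)/3]`, the tangent at `F = 1`
to `J₃` lies below the line through `(1/4, F_BD)` and `(1, 1)` on all of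
`[1/4, 1]`. -/
theorem stmt_17 (FBD l3 : ℝ)
    (hFBD : FBD ∈ Set.Ioc (1/2 : ℝ) 1)
    (hl3 : l3 ∈ Set.Icc (0:ℝ) ((1 - FBD) / 3))
    (Jtan JUB : ℝ → ℝ)
    (hJtan : ∀ F : ℝ, Jtan F
      = (2 * FBD / (3 * (FBD + l3) ^ 2) - 1/3) * (F - 1) + FBD / (FBD + l3))
    (hJUB : ∀ F : ℝ, JUB F = (4 * (1 - FBD) / 3) * F + (4 * FBD - 1) / 3) :
    ∀ F ∈ Set.Icc (1/4 : ℝ) 1, Jtan F ≤ JUB F := by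
  obtain ⟨hx, hx1⟩ := hFBD
  obtain ⟨hl0, -⟩ := hl3
  rintro F ⟨hF, hF1⟩
  have hs : 0 < FBD + l3 := by linarith
  have right_end : FBD / (FBD + l3) ≤ 1 := by
    rw [div_le_one hs]
    linarith
  have quadratic_pos : 0 ≤ (4 * FBD - 1) * (FBD + l3) ^ 2 - 4 * FBD * (FBD + l3) + 2 * FBD := by
    have h : 0 < 4 * FBD - 1 := by linarith
    refine nonneg_of_mul_nonneg_right ?_ h
    nlinarith [sq_nonneg ((4 * FBD - 1) * (FBD + l3) - 2 * FBD)]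
  have left_end :
      (2 * FBD / (3 * (FBD + l3) ^ 2) - 1 / 3) * (1 / 4 - 1) + FBD / (FBD + l3) ≤ FBD := by
    rw [← sub_nonneg]
    have h : FBD - ((2 * FBD / (3 * (FBD + l3) ^ 2) - 1 / 3) * (1 / 4 - 1) + FBD / (FBD + l3))
        = ((4 * FBD - 1) * (FBD + l3) ^ 2 - 4 * FBD * (FBD + l3) + 2 * FBD)
          / (4 * (FBD + l3) ^ 2) := by
      field_simp
      ring
    rw [h]
    positivity
  rw [hJtan, hJUB]
  linear_combination (4 / 3 * (F - 1 / 4)) * right_end + (4 / 3 * (1 - F)) * left_end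
end
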